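/- Let n ≥ 2, let V ⊆ ℝⁿ be an open neighborhood of the origin, let v : V → ℝⁿ be continuous, and let w : V → ℝⁿ be differentiable at 0 with w(0) = 0 and such that the Fréchet derivative Dw(0) : ℝⁿ → ℝⁿ has rank at least 2 (in particular this holds when Dw(0) is invertible, e.g. when 0 is a hyperbolic zero of w). If v(x) and w(x) are linearly dependent for every x ∈ V, then v(0) = 0. -/

import Mathlib

open Filter Topology

/-- The `2 × 2` minors of a linearly dependent pair of vectors vanish. -/
theorem mul_eq_mul_of_not_linearIndependent_pair {ι K : Type*} [Field K] {a b : ι → K}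
    (h : ¬ LinearIndependent K ![a, b]) (i j : ι) : a i * b j = a j * b i := by
  rw [LinearIndependent.pair_iff] at h
  push Not at h
  obtain ⟨s, t, hst, hne⟩ := h
  have hi : s * a i + t * b i = 0 := by simpa using congrFun hst i
  have hj : s * a j + t * b j = 0 := by simpa using congrFun hst j
  by_cases hs : s = 0
  · have ht : t ≠ 0 := hne hs
    apply mul_left_cancel₀ ht
    linear_combination a i * hj - a j * hi
  · apply mul_left_cancel₀ hs
    linear_combination b j * hi - b i * hj

/-- If `v` is continuous at `0`, `w 0 = 0`, and `v`, `w` are linearly dependent near `0`, then the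
minors of `v 0` and `Dw(0) h` vanish for every `h`. -/
theorem mul_fderiv_eq_of_eventually_not_linearIndependent {E ι : Type*} [NormedAddCommGroup E]
    [NormedSpace ℝ E] [Fintype ι] {v w : E → ι → ℝ} (hv : ContinuousAt v 0)
    (hw : DifferentiableAt ℝ w 0) (hw0 : w 0 = 0)
    (hdep : ∀ᶠ x in 𝓝 0, ¬ LinearIndependent ℝ ![v x, w x]) (h : E) (i j : ι) :
    v 0 i * fderiv ℝ w 0 h j = v 0 j * fderiv ℝ w 0 h i := by
  have hline : Tendsto (fun t : ℝ => t • h) (𝓝[≠] 0) (𝓝 0) := by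
    have : Continuous fun t : ℝ => t • h := by fun_prop
    simpa using (this.tendsto 0).mono_left nhdsWithin_le_nhds
  have hslope : Tendsto (fun t : ℝ => t⁻¹ • w (t • h)) (𝓝[≠] 0) (𝓝 (fderiv ℝ w 0 h)) := by
    simpa [hw0] using (hw.hasFDerivAt.hasLineDerivAt h).tendsto_slope_zero
  have hlim (k l : ι) : Tendsto (fun t : ℝ => v (t • h) k * (t⁻¹ • w (t • h)) l) (𝓝[≠] 0)
      (𝓝 (v 0 k * fderiv ℝ w 0 h l)) :=
    ((tendsto_pi_nhds.1 hv k).comp hline).mul (tendsto_pi_nhds.1 hslope l)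
  refine tendsto_nhds_unique_of_eventuallyEq (hlim i j) (hlim j i) ?_
  filter_upwards [hline.eventually hdep] with t ht
  have := mul_eq_mul_of_not_linearIndependent_pair ht i j
  simp only [Pi.smul_apply, smul_eq_mul]
  linear_combination t⁻¹ * this

/-- **Flow-box sub-claim of the division lemma.**
Let `V ⊆ ℝⁿ` (`n ≥ 2`) be an open neighborhood of the origin, `v : V → ℝⁿ` continuous,
and `w : V → ℝⁿ` differentiable at `0` with `w(0) = 0` and `rank Dw(0) ≥ 2` (which holds in
particular when `0` is a hyperbolic zero of `w`). If `v(x)` and `w(x)` are linearly dependent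
for every `x ∈ V`, then `v(0) = 0`. -/
theorem collinear_with_nondegenerate_zero_vanishes
    (n : ℕ) (hn : 2 ≤ n)
    (V : Set (Fin n → ℝ)) (hV : IsOpen V) (h0V : (0 : Fin n → ℝ) ∈ V)
    (v w : (Fin n → ℝ) → (Fin n → ℝ))
    (hv : ContinuousOn v V)
    (hw : DifferentiableAt ℝ w 0) (hw0 : w 0 = 0)
    (hrank : 2 ≤ LinearMap.rank ((fderiv ℝ w 0) : (Fin n → ℝ) →ₗ[ℝ] (Fin n → ℝ)))
    (hdep : ∀ x ∈ V, ¬ LinearIndependent ℝ ![v x, w x]) :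
    v 0 = 0 := by
  by_contra hne
  obtain ⟨i, hi⟩ := Function.ne_iff.1 hne
  have hminor := mul_fderiv_eq_of_eventually_not_linearIndependent
    (hv.continuousAt (hV.mem_nhds h0V)) hw hw0
    (Filter.mem_of_superset (hV.mem_nhds h0V) hdep)
  have hle : LinearMap.range ((fderiv ℝ w 0) : (Fin n → ℝ) →ₗ[ℝ] (Fin n → ℝ)) ≤
      Submodule.span ℝ {v 0} := by
    rintro _ ⟨h, rfl⟩
    refine Submodule.mem_span_singleton.2 ⟨fderiv ℝ w 0 h i / v 0 i, ?_⟩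
    ext j
    have hi' : v 0 i ≠ 0 := hi
    simp only [Pi.smul_apply, smul_eq_mul, ContinuousLinearMap.coe_coe]
    field_simp
    linear_combination -hminor h i j
  have hone : LinearMap.rank ((fderiv ℝ w 0) : (Fin n → ℝ) →ₗ[ℝ] (Fin n → ℝ)) ≤ 1 :=
    (Submodule.rank_mono hle).trans ((rank_span_le _).trans (by simp))
  exact absurd (hrank.trans hone) (by norm_num)
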